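/- Let q be a real number and let j ≥ 1 and 1 ≤ m ≤ j be integers. Then: S_q(2^j) = (2q)^m·S_q(2^{j−m}) + 2^{j−1}·(q + q² + ⋯ + q^m) = (2q)^m·S_q(2^{j−m}) + 2^{j−1}·q·Σ_{i=0}^{m−1} q^i. -/

import Mathlib

noncomputable section

open MeasureTheory Filter Finset

/-- Distance from `x` to the nearest integer. -/
def distInt (x : ℝ) : ℝ := |x - round x|

/-- The Takagi–Landsberg function with parameter `a`:
`𝒯_a(x) = ∑_{n≥0} a^n · dist(2^n x, ℤ)`. -/
def takagi (a : ℝ) (x : ℝ) : ℝ := ∑' n : ℕ, a ^ n * distInt (2 ^ n * x)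

/-- Weighted sum-of-binary-digits function: for `j = ∑ ω_i 2^i`,
`s_q(j) = ∑ ω_i q^{i+1}`. -/
def sqN (q : ℝ) (j : ℕ) : ℝ := ∑ i ∈ Finset.range j, if j.testBit i then q ^ (i + 1) else 0

/-- `S_q(n) = ∑_{j<n} s_q(j)`. -/
def Sq (q : ℝ) (n : ℕ) : ℝ := ∑ j ∈ Finset.range n, sqN q j

lemma sqN_eq_sum_range (q : ℝ) {j n : ℕ} (h : j ≤ n) :
    sqN q j = ∑ i ∈ Finset.range n, if j.testBit i then q ^ (i + 1) else 0 := by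
  refine Finset.sum_subset (Finset.range_mono h) fun i _ hi => ?_
  have hji : j < 2 ^ i :=
    (Nat.lt_two_pow_self (n := j)).trans_le
      (Nat.pow_le_pow_right two_pos (by simpa using hi))
  simp [Nat.testBit_lt_two_pow hji]

lemma sqN_two_mul (q : ℝ) (j : ℕ) : sqN q (2 * j) = q * sqN q j := by
  rw [sqN_eq_sum_range q (show 2 * j ≤ 2 * j + 1 by omega), Finset.sum_range_succ',
    sqN_eq_sum_range q (show j ≤ 2 * j by omega), Finset.mul_sum]
  simp [Nat.testBit_succ, pow_succ', mul_ite]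

lemma sqN_two_mul_add_one (q : ℝ) (j : ℕ) : sqN q (2 * j + 1) = q * sqN q j + q := by
  rw [sqN, Finset.sum_range_succ', sqN_eq_sum_range q (show j ≤ 2 * j by omega),
    Finset.mul_sum]
  have h : (2 * j + 1) / 2 = j := by omega
  simp [Nat.testBit_succ, h, pow_succ', mul_ite]

lemma Sq_two_mul (q : ℝ) (n : ℕ) : Sq q (2 * n) = 2 * q * Sq q n + n * q := by
  induction n with
  | zero => simp [Sq]
  | succ n ih =>
    have h₁ : Sq q (2 * (n + 1)) = Sq q (2 * n) + sqN q (2 * n) + sqN q (2 * n + 1) := by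
      simp only [Sq, Nat.mul_succ, Finset.sum_range_succ]
    have h₂ : Sq q (n + 1) = Sq q n + sqN q n := by
      simp only [Sq, Finset.sum_range_succ]
    rw [h₁, h₂, ih, sqN_two_mul, sqN_two_mul_add_one]
    push_cast
    ring

lemma Sq_pow_two_add (q : ℝ) (k m : ℕ) :
    2 * Sq q (2 ^ (k + m)) = 2 * ((2 * q) ^ m * Sq q (2 ^ k)) +
      (2 : ℝ) ^ (k + m) * (q * ∑ i ∈ Finset.range m, q ^ i) := by
  induction m with
  | zero => simp
  | succ m ih =>
    rw [← add_assoc, pow_succ' 2 (k + m), Sq_two_mul, Finset.sum_range_succ']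
    simp only [pow_succ' q, ← Finset.mul_sum]
    push_cast
    linear_combination 2 * q * ih

theorem Sq_pow_two_split (q : ℝ) (j m : ℕ) (hj : 1 ≤ j) (hm1 : 1 ≤ m) (hmj : m ≤ j) :
    Sq q (2 ^ j) = (2 * q) ^ m * Sq q (2 ^ (j - m)) + (2 : ℝ) ^ (j - 1) * (∑ i ∈ Finset.Icc 1 m, q ^ i) ∧
    Sq q (2 ^ j) = (2 * q) ^ m * Sq q (2 ^ (j - m))
      + (2 : ℝ) ^ (j - 1) * q * (∑ i ∈ Finset.range m, q ^ i) := by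
  have hsum : ∑ i ∈ Finset.Icc 1 m, q ^ i = q * ∑ i ∈ Finset.range m, q ^ i := by
    rw [Finset.mul_sum, ← Finset.Ico_add_one_right_eq_Icc, Finset.sum_Ico_eq_sum_range]
    simp [pow_add]
  have hpow : (2 : ℝ) ^ j = 2 * 2 ^ (j - 1) := by
    rw [← pow_succ', Nat.sub_add_cancel hj]
  have h := Sq_pow_two_add q (j - m) m
  rw [Nat.sub_add_cancel hmj, hpow] at h
  rw [hsum, mul_assoc _ q, and_self]
  linarith

end
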